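/- For every n ∈ ℕ with n ≥ 1 and every x ∈ I_{n+1}(e_{n−1} + e_n), one has |K_{M_n}(x)| = M_{n−1} / |1 − r_{n−1}(x)| = M_{n−1} / (2 sin(π / m_{n−1})). -/

import Mathlib

open MeasureTheory Finset

noncomputable section

namespace Vilenkin

instance (n : ℕ) : MeasurableSpace (ZMod n) := ⊤

abbrev G (m : ℕ → ℕ) : Type := ∀ k, ZMod (m k)

def M (m : ℕ → ℕ) : ℕ → ℕ
  | 0 => 1
  | k + 1 => m k * M m k

def digit (m : ℕ → ℕ) (n k : ℕ) : ℕ := (n / M m k) % m k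

def rad (m : ℕ → ℕ) (k : ℕ) (x : G m) : ℂ :=
  Complex.exp (2 * (Real.pi : ℂ) * Complex.I * ((x k).val : ℂ) / (m k : ℂ))

def psi (m : ℕ → ℕ) (n : ℕ) (x : G m) : ℂ :=
  ∏ k ∈ Finset.range (n + 1), rad m k x ^ digit m n k

def D (m : ℕ → ℕ) (n : ℕ) (x : G m) : ℂ := ∑ k ∈ Finset.range n, psi m k x

def K (m : ℕ → ℕ) (n : ℕ) (x : G m) : ℂ := (n : ℂ)⁻¹ * ∑ k ∈ Finset.range n, D m k x

def cyl (m : ℕ → ℕ) (n : ℕ) (x : G m) : Set (G m) := {y | ∀ j < n, y j = x j}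

def e (m : ℕ → ℕ) (k : ℕ) : G m := fun j => if j = k then 1 else 0

def lo (m : ℕ → ℕ) (n : ℕ) : ℕ := sInf {j | digit m n j ≠ 0}

def hi (m : ℕ → ℕ) (n : ℕ) : ℕ := sSup {j | digit m n j ≠ 0}

def Iij (m : ℕ → ℕ) (N i j : ℕ) : Set (G m) :=
  if j = N then {x | x i ≠ 0 ∧ ∀ t < N, t ≠ i → x t = 0}
  else {x | (∀ t < i, x t = 0) ∧ x i ≠ 0 ∧ (∀ t, i < t → t < j → x t = 0) ∧ x j ≠ 0}

def IsVilenkinMeasure (m : ℕ → ℕ) (μ : Measure (G m)) : Prop :=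
  IsProbabilityMeasure μ ∧ ∀ (n : ℕ) (x : G m), μ (cyl m n x) = (M m n : ENNReal)⁻¹

def fhat (m : ℕ → ℕ) (μ : Measure (G m)) (f : G m → ℂ) (k : ℕ) : ℂ :=
  ∫ x, f x * (starRingEnd ℂ) (psi m k x) ∂μ

def S (m : ℕ → ℕ) (μ : Measure (G m)) (f : G m → ℂ) (n : ℕ) (x : G m) : ℂ :=
  ∑ k ∈ Finset.range n, fhat m μ f k * psi m k x

def sigma (m : ℕ → ℕ) (μ : Measure (G m)) (f : G m → ℂ) (n : ℕ) (x : G m) : ℂ :=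
  (n : ℂ)⁻¹ * ∑ k ∈ Finset.range n, S m μ f k x

end Vilenkin

open Vilenkin

namespace Vilenkin

lemma M_pos {m : ℕ → ℕ} (hm : ∀ k, 2 ≤ m k) (k : ℕ) : 0 < M m k := by
  induction k with
  | zero => simp [M]
  | succ k ih => exact Nat.mul_pos (by linarith [hm k]) ih

lemma M_mono {m : ℕ → ℕ} (hm : ∀ k, 2 ≤ m k) : Monotone (M m) :=
  monotone_nat_of_le_succ fun k => Nat.le_mul_of_pos_left _ (by linarith [hm k])

lemma lt_M {m : ℕ → ℕ} (hm : ∀ k, 2 ≤ m k) (k : ℕ) : k < M m k := by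
  induction k with
  | zero => simp [M]
  | succ k ih =>
    have : 2 * M m k ≤ m k * M m k := Nat.mul_le_mul_right _ (hm k)
    simp only [M]
    omega

lemma digit_eq_zero {m : ℕ → ℕ} {n k : ℕ} (h : n < M m k) : digit m n k = 0 := by
  simp [digit, Nat.div_eq_of_lt h]

lemma psi_eq_rad_pow {m : ℕ → ℕ} (hm : ∀ k, 2 ≤ m k) {p : ℕ} {x : G m}
    (hx : ∀ j < p, x j = 0) {k : ℕ} (hk : k < M m (p + 1)) :
    psi m k x = rad m p x ^ (k / M m p) := by
  have hdigit : digit m k p = k / M m p :=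
    Nat.mod_eq_of_lt (Nat.div_lt_of_lt_mul (by rwa [mul_comm]))
  rw [psi, ← hdigit]
  refine Finset.prod_eq_single p (fun j _ hjp => ?_) fun hp => ?_
  · rcases lt_or_gt_of_ne hjp with h | h
    · simp [rad, hx j h]
    · rw [digit_eq_zero (hk.trans_le (M_mono hm h)), pow_zero]
  · have hkp : k ≤ p := by
      simp only [Finset.mem_range, not_lt] at hp
      omega
    rw [digit_eq_zero (hkp.trans_lt (lt_M hm p)), pow_zero]

lemma one_sub_mul_sum_pow_div {R : Type*} [CommRing R] (r : R) {A : ℕ} (hA : 0 < A) (b a : ℕ)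
    (ha : a ≤ A) :
    (1 - r) * ∑ j ∈ Finset.range (A * b + a), r ^ (j / A) =
      A * (1 - r ^ b) + a * ((1 - r) * r ^ b) := by
  have block : ∀ b a, a ≤ A → ∑ j ∈ Finset.range a, r ^ ((A * b + j) / A) = a * r ^ b := by
    intro b a ha
    rw [Finset.sum_congr rfl (g := fun _ => r ^ b), Finset.sum_const, Finset.card_range,
      nsmul_eq_mul]
    intro j hj
    rw [Nat.mul_add_div hA, Nat.div_eq_of_lt ((Finset.mem_range.mp hj).trans_le ha), add_zero]
  have full : (1 - r) * ∑ j ∈ Finset.range (A * b), r ^ (j / A) = A * (1 - r ^ b) := by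
    induction b with
    | zero => simp
    | succ b ih =>
      rw [Nat.mul_succ, Finset.sum_range_add, mul_add, ih, block b A le_rfl]
      ring
  rw [Finset.sum_range_add, mul_add, full, block b a ha]
  ring

lemma one_sub_mul_sum_sum_pow_div {R : Type*} [CommRing R] (r : R) {A : ℕ} (hA : 0 < A) (q : ℕ) :
    (1 - r) * ∑ k ∈ Finset.range (A * q), ∑ j ∈ Finset.range k, r ^ (j / A) =
      A ^ 2 * (q - ∑ c ∈ Finset.range q, r ^ c) +
        (∑ a ∈ Finset.range A, (a : R)) * ((1 - r) * ∑ c ∈ Finset.range q, r ^ c) := by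
  induction q with
  | zero => simp
  | succ q ih =>
    have block : (1 - r) * ∑ a ∈ Finset.range A, ∑ j ∈ Finset.range (A * q + a), r ^ (j / A) =
        A * (A * (1 - r ^ q)) + (∑ a ∈ Finset.range A, (a : R)) * ((1 - r) * r ^ q) := by
      rw [Finset.mul_sum, Finset.sum_congr rfl fun a ha =>
        one_sub_mul_sum_pow_div r hA q a (Finset.mem_range.mp ha).le,
        Finset.sum_add_distrib, Finset.sum_mul, Finset.sum_const, Finset.card_range,
        nsmul_eq_mul]
    rw [Nat.mul_succ, Finset.sum_range_add, mul_add, ih, block, Finset.sum_range_succ]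
    push_cast
    ring

lemma K_M_succ {m : ℕ → ℕ} (hm : ∀ k, 2 ≤ m k) {p : ℕ} {x : G m} (hx : ∀ j < p, x j = 0)
    (hroot : rad m p x ^ m p = 1) (hne : rad m p x ≠ 1) :
    K m (M m (p + 1)) x = M m p / (1 - rad m p x) := by
  have hA := M_pos hm p
  have hsum : ∑ k ∈ Finset.range (M m (p + 1)), D m k x =
      ∑ k ∈ Finset.range (M m p * m p), ∑ j ∈ Finset.range k, rad m p x ^ (j / M m p) := by
    rw [mul_comm (M m p)]
    refine Finset.sum_congr rfl fun k hk => Finset.sum_congr rfl fun j hj => ?_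
    exact psi_eq_rad_pow hm hx ((Finset.mem_range.mp hj).trans (Finset.mem_range.mp hk))
  have hgeom : ∑ c ∈ Finset.range (m p), rad m p x ^ c = 0 := by
    rw [geom_sum_eq hne, hroot, sub_self, zero_div]
  have key := one_sub_mul_sum_sum_pow_div (rad m p x) hA (m p)
  rw [hgeom, mul_zero, mul_zero, sub_zero, add_zero, ← hsum] at key
  have h1 : 1 - rad m p x ≠ 0 := sub_ne_zero.mpr hne.symm
  have h2 : (M m p : ℂ) ≠ 0 := by exact_mod_cast hA.ne'
  have h3 : (m p : ℂ) ≠ 0 := by exact_mod_cast (show m p ≠ 0 by linarith [hm p])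
  rw [K, eq_div_iff h1, mul_assoc, mul_comm _ (1 - rad m p x), key, M]
  push_cast
  field_simp

lemma norm_one_sub_exp_two_pi_div {q : ℕ} (hq : 2 ≤ q) :
    ‖1 - Complex.exp (2 * (Real.pi : ℂ) * Complex.I / (q : ℂ))‖ =
      2 * Real.sin (Real.pi / q) := by
  have hq' : (1 : ℝ) ≤ q := by exact_mod_cast (by omega : 1 ≤ q)
  have hsin : 0 ≤ Real.sin (Real.pi / q) :=
    Real.sin_nonneg_of_nonneg_of_le_pi (by positivity) (div_le_self Real.pi_pos.le hq')
  have harg : 2 * (Real.pi : ℂ) * Complex.I / (q : ℂ) =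
      Complex.I * ((2 * Real.pi / q : ℝ) : ℂ) := by
    push_cast
    ring
  rw [norm_sub_rev, harg, Complex.norm_exp_I_mul_ofReal_sub_one,
    show 2 * Real.pi / q / 2 = Real.pi / q by ring, Real.norm_of_nonneg (by positivity)]

end Vilenkin

theorem statement8 (m : ℕ → ℕ) (hm : ∀ k, 2 ≤ m k) (n : ℕ) (hn : 1 ≤ n)
    (x : G m) (hx : x ∈ cyl m (n + 1) (e m (n - 1) + e m n)) :
    ‖K m (M m n) x‖ = (M m (n - 1) : ℝ) / ‖1 - rad m (n - 1) x‖ ∧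
    ‖K m (M m n) x‖ = (M m (n - 1) : ℝ) / (2 * Real.sin (Real.pi / m (n - 1))) := by
  obtain ⟨p, rfl⟩ : ∃ p, n = p + 1 := ⟨n - 1, by omega⟩
  rw [Nat.add_sub_cancel] at hx ⊢
  have hx0 : ∀ j < p, x j = 0 := fun j hj => by
    rw [hx j (by omega)]
    simp [e, show j ≠ p by omega, show j ≠ p + 1 by omega]
  have hxp : x p = 1 := by
    rw [hx p (by omega)]
    simp [e]
  have hrad : rad m p x = Complex.exp (2 * (Real.pi : ℂ) * Complex.I / (m p : ℂ)) := by
    have : Fact (1 < m p) := ⟨hm p⟩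
    rw [rad, hxp, ZMod.val_one]
    simp
  have hprim := Complex.isPrimitiveRoot_exp (m p) (by linarith [hm p])
  rw [← hrad] at hprim
  have hK : ‖K m (M m (p + 1)) x‖ = (M m p : ℝ) / ‖1 - rad m p x‖ := by
    rw [K_M_succ hm hx0 hprim.pow_eq_one (hprim.ne_one (hm p)), norm_div, Complex.norm_natCast]
  refine ⟨hK, ?_⟩
  rw [hK, hrad, norm_one_sub_exp_two_pi_div (hm p)]
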